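/- arXiv:1404.0145 — 2 statements merged into one kernel-verified Lean document; each statement's English description precedes it below -/
import Mathlib

section
/- Consider n ≥ 2 agents on a time-invariant connected undirected graph 𝒢(𝒱,ℰ) updating by the Wasserstein consensus protocol with p = 2. Then for every i ∈ 𝒱 and every t ∈ ℕ, the quantile function of the updated measure satisfies F_{μ_i(t+1)}^+(u) = Σ_{j∈𝒩_i} w_ij F_{μ_j(t)}^+(u) for almost every u ∈ (0,1); i.e. the nonlinear Wasserstein consensus protocol acts as the linear consensus iteration F^+(t+1) = W F^+(t) on the vector of agents' quantile functions. -/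
open MeasureTheory Filter Topology

noncomputable section

/-- The set of couplings (transport plans) between two Borel probability measures on ℝ. -/
def Couplings (μ ν : Measure ℝ) : Set (Measure (ℝ × ℝ)) :=
  {γ | IsProbabilityMeasure γ ∧ γ.map Prod.fst = μ ∧ γ.map Prod.snd = ν}

/-- The `p`-Wasserstein distance `ℓ_p` between measures on ℝ. -/
def Wp (p : ℝ) (μ ν : Measure ℝ) : ℝ :=
  ((⨅ γ ∈ Couplings μ ν,
      ∫⁻ z : ℝ × ℝ, ENNReal.ofReal (|z.1 - z.2| ^ p) ∂γ) ^ (1 / p)).toReal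

/-- Membership in `𝒰_p(ℝ)`: Borel probability measures on ℝ with finite `p`-th moment. -/
def MemUp (p : ℝ) (μ : Measure ℝ) : Prop :=
  IsProbabilityMeasure μ ∧ (∫⁻ x : ℝ, ENNReal.ofReal (|x| ^ p) ∂μ) < ⊤

/-- `η` is a Wasserstein barycenter (a minimizer over `𝒰_p(ℝ)` of the weighted sum of
`p`-th powers of `p`-Wasserstein distances) of the family `μs` with weights `w`. -/
def IsBarycenter (p : ℝ) {m : ℕ} (w : Fin m → ℝ) (μs : Fin m → Measure ℝ)
    (η : Measure ℝ) : Prop :=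
  MemUp p η ∧ ∀ χ : Measure ℝ, MemUp p χ →
    ∑ j, w j * Wp p η (μs j) ^ p ≤ ∑ j, w j * Wp p χ (μs j) ^ p

/-- Valid consensus weights: entries in `[0,1]`, positivity pattern symmetric (undirected
network, neighbour `j ∈ 𝒩_i ↔ w i j > 0`), positive diagonal, rows summing to one. -/
def ValidWeights {n : ℕ} (w : Fin n → Fin n → ℝ) : Prop :=
  (∀ i j, w i j ∈ Set.Icc (0 : ℝ) 1) ∧ (∀ i j, 0 < w i j ↔ 0 < w j i) ∧
    (∀ i, 0 < w i i) ∧ (∀ i, ∑ j, w i j = 1)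

/-- One step of the Wasserstein consensus protocol: each agent `i` moves to the unique
minimizer of `η ↦ ∑_j w i j * ℓ_p(η, μs j)^p` over `𝒰_p(ℝ)`. -/
def ConsensusStep (p : ℝ) {n : ℕ} (w : Fin n → Fin n → ℝ) (μs μ' : Fin n → Measure ℝ) : Prop :=
  ∀ i, IsBarycenter p (w i) μs (μ' i) ∧ ∀ χ, IsBarycenter p (w i) μs χ → χ = μ' i

/-- The Wasserstein convex hull of a finite family of measures: the set of all their
Wasserstein barycenters over all weight vectors. -/
def WCoHull (p : ℝ) {m : ℕ} (μs : Fin m → Measure ℝ) : Set (Measure ℝ) :=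
  {η | ∃ w : Fin m → ℝ, (∀ j, 0 ≤ w j) ∧ (∑ j, w j = 1) ∧ IsBarycenter p w μs η}

/-- The Lyapunov-like quantity `ν`: the maximum over pairs of agents of the `p`-th power of
the `p`-Wasserstein distance between their states. -/
def maxWp (p : ℝ) {m : ℕ} (μs : Fin m → Measure ℝ) : ℝ :=
  ⨆ i : Fin m, ⨆ j : Fin m, Wp p (μs i) (μs j) ^ p

/-- The quantile function (generalized inverse cumulative distribution function) `F_μ⁺`. -/
def qf (μ : Measure ℝ) (u : ℝ) : ℝ :=
  sInf {x : ℝ | u ≤ (μ (Set.Iic x)).toReal}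

/-- Lebesgue measure on (0,1). -/
def lam : Measure ℝ := volume.restrict (Set.Ioo (0 : ℝ) 1)

instance lam_prob : IsProbabilityMeasure lam := by
  constructor; simp [lam]

theorem qf_le_iff (μ : Measure ℝ) [IsProbabilityMeasure μ] {u : ℝ} (hu : u ∈ Set.Ioo (0 : ℝ) 1)
    (x : ℝ) : qf μ u ≤ x ↔ u ≤ (μ (Set.Iic x)).toReal := by
  have hF : ∀ x, (μ (Set.Iic x)).toReal = ProbabilityTheory.cdf μ x := by
    intro x; rw [ProbabilityTheory.cdf_eq_real]; rfl
  unfold qf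
  simp only [hF]
  set F := ProbabilityTheory.cdf μ
  have hmono : Monotone F := ProbabilityTheory.monotone_cdf μ
  have hbdd : BddBelow {x | u ≤ F x} := by
    obtain ⟨y, hy⟩ := ((ProbabilityTheory.tendsto_cdf_atBot μ).eventually_lt_const hu.1).exists
    refine ⟨y, fun z hz => ?_⟩
    by_contra! h
    exact absurd (hmono h.le) (not_le.2 (lt_of_lt_of_le hy hz))
  have hne : {x | u ≤ F x}.Nonempty := by
    obtain ⟨y, hy⟩ := ((ProbabilityTheory.tendsto_cdf_atTop μ).eventually_const_lt hu.2).exists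
    exact ⟨y, hy.le⟩
  constructor
  · intro h
    by_contra! hlt
    have hc : ContinuousWithinAt F (Set.Ici x) x := F.right_continuous x
    have h1 : ∀ᶠ y in 𝓝[>] x, F y < u :=
      (hc.mono Set.Ioi_subset_Ici_self).tendsto.eventually_lt_const hlt
    obtain ⟨y, hy, hxy⟩ := (h1.and self_mem_nhdsWithin).exists
    have hxy : x < y := hxy
    obtain ⟨z, hz, hzy⟩ := exists_lt_of_csInf_lt hne (lt_of_le_of_lt h hxy)
    exact absurd (hmono hzy.le) (not_le.2 (lt_of_lt_of_le hy hz))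
  · intro h
    exact csInf_le hbdd h

theorem qf_mono (μ : Measure ℝ) [IsProbabilityMeasure μ] :
    MonotoneOn (qf μ) (Set.Ioo (0 : ℝ) 1) := by
  intro u hu v hv huv
  rw [qf_le_iff μ hu]
  exact huv.trans ((qf_le_iff μ hv _).1 le_rfl)

theorem aem_of_mono {f : ℝ → ℝ} (hf : MonotoneOn f (Set.Ioo (0 : ℝ) 1)) : AEMeasurable f lam :=
  aemeasurable_restrict_of_monotoneOn measurableSet_Ioo hf

theorem lam_Iic_of {c : ℝ} (h0 : 0 ≤ c) (h1 : c ≤ 1) :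
    lam (Set.Iic c) = ENNReal.ofReal c := by
  unfold lam
  rw [Measure.restrict_apply measurableSet_Iic]
  apply le_antisymm
  · calc volume (Set.Iic c ∩ Set.Ioo 0 1) ≤ volume (Set.Ioc 0 c) :=
          measure_mono fun x hx => ⟨hx.2.1, hx.1⟩
      _ = _ := by simp
  · calc ENNReal.ofReal c = volume (Set.Ioo 0 c) := by simp
      _ ≤ volume (Set.Iic c ∩ Set.Ioo 0 1) := measure_mono fun x hx => ⟨hx.2.le, hx.1, hx.2.trans_le h1⟩

theorem map_qf (μ : Measure ℝ) [IsProbabilityMeasure μ] : lam.map (qf μ) = μ := by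
  have hm := aem_of_mono (qf_mono μ)
  have : IsProbabilityMeasure (lam.map (qf μ)) := Measure.isProbabilityMeasure_map hm
  apply Measure.ext_of_Iic
  intro x
  rw [Measure.map_apply_of_aemeasurable hm measurableSet_Iic]
  have : lam (qf μ ⁻¹' Set.Iic x) = lam (Set.Iic (μ (Set.Iic x)).toReal) := by
    apply measure_congr
    have : ∀ᵐ u ∂lam, u ∈ Set.Ioo (0 : ℝ) 1 := ae_restrict_mem measurableSet_Ioo
    filter_upwards [this] with u hu
    exact propext (qf_le_iff μ hu x)
  rw [this, lam_Iic_of ENNReal.toReal_nonneg, ENNReal.ofReal_toReal (measure_ne_top _ _)]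
  exact ENNReal.toReal_le_of_le_ofReal zero_le_one (by simpa using prob_le_one)

theorem sq_eq_area (x y : ℝ) : ENNReal.ofReal (|x - y| ^ (2 : ℝ)) =
    (volume : Measure (ℝ × ℝ)) (Set.Ico x y ×ˢ Set.Ico x y)
      + (volume : Measure (ℝ × ℝ)) (Set.Ico y x ×ˢ Set.Ico y x) := by
  rw [Measure.volume_eq_prod, Measure.prod_prod, Measure.prod_prod, Real.volume_Ico,
    Real.volume_Ico, Real.rpow_two, sq_abs]
  rcases le_total x y with h | h
  · rw [ENNReal.ofReal_of_nonpos (sub_nonpos.2 h), ← ENNReal.ofReal_mul (sub_nonneg.2 h)]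
    simp; congr 1; ring
  · rw [ENNReal.ofReal_of_nonpos (sub_nonpos.2 h), ← ENNReal.ofReal_mul (sub_nonneg.2 h)]
    simp; congr 1; ring

theorem meas_and {α : Type*} [MeasurableSpace α] {f g h k : α → ℝ} (hf : Measurable f)
    (hg : Measurable g) (hh : Measurable h) (hk : Measurable k) :
    MeasurableSet {a | f a ≤ g a ∧ h a < k a} :=
  MeasurableSet.inter (measurableSet_le hf hg) (measurableSet_lt hh hk)

theorem cost_eq (γ : Measure (ℝ × ℝ)) [IsProbabilityMeasure γ] :
    ∫⁻ z : ℝ × ℝ, ENNReal.ofReal (|z.1 - z.2| ^ (2 : ℝ)) ∂γ =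
      (∫⁻ p : ℝ × ℝ, γ {z | z.1 ≤ min p.1 p.2 ∧ max p.1 p.2 < z.2}) +
      ∫⁻ p : ℝ × ℝ, γ {z | z.2 ≤ min p.1 p.2 ∧ max p.1 p.2 < z.1} := by
  have m1 : MeasurableSet {q : (ℝ × ℝ) × (ℝ × ℝ) |
      q.1.1 ≤ min q.2.1 q.2.2 ∧ max q.2.1 q.2.2 < q.1.2} :=
    by apply meas_and <;> fun_prop
  have m2 : MeasurableSet {q : (ℝ × ℝ) × (ℝ × ℝ) |
      q.1.2 ≤ min q.2.1 q.2.2 ∧ max q.2.1 q.2.2 < q.1.1} :=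
    by apply meas_and <;> fun_prop
  have e1 := (Measure.prod_apply (μ := γ) (ν := (volume : Measure (ℝ × ℝ))) m1).symm.trans
    (Measure.prod_apply_symm m1)
  have e2 := (Measure.prod_apply (μ := γ) (ν := (volume : Measure (ℝ × ℝ))) m2).symm.trans
    (Measure.prod_apply_symm m2)
  have e3 : ∀ x y : ℝ, Set.Ico x y ×ˢ Set.Ico x y =
      {p : ℝ × ℝ | x ≤ min p.1 p.2 ∧ max p.1 p.2 < y} := by
    intro x y; ext p; simp; tauto
  simp_rw [sq_eq_area, e3]
  rw [lintegral_add_left]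
  · exact congrArg₂ (· + ·) e1 e2
  · exact measurable_measure_prodMk_left m1

theorem comono_le {μ ν : Measure ℝ} [IsProbabilityMeasure μ] [IsProbabilityMeasure ν] (s t : ℝ) :
    lam {u | qf μ u ≤ s ∧ t < qf ν u} ≤ μ (Set.Iic s) - ν (Set.Iic t) := by
  have h : lam {u | qf μ u ≤ s ∧ t < qf ν u} ≤
      volume (Set.Ioc (ν (Set.Iic t)).toReal (μ (Set.Iic s)).toReal) := by
    unfold lam
    rw [Measure.restrict_apply' measurableSet_Ioo]
    apply measure_mono
    rintro u ⟨⟨h1, h2⟩, hu⟩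
    refine ⟨?_, (qf_le_iff μ hu s).1 h1⟩
    by_contra! h
    exact absurd ((qf_le_iff ν hu t).2 h) (not_le.2 h2)
  refine h.trans ?_
  rw [Real.volume_Ioc, ENNReal.ofReal_sub _ ENNReal.toReal_nonneg,
    ENNReal.ofReal_toReal (measure_ne_top _ _), ENNReal.ofReal_toReal (measure_ne_top _ _)]

theorem coupling_ge {μ ν : Measure ℝ} {γ : Measure (ℝ × ℝ)} [IsProbabilityMeasure γ]
    (f g : ℝ × ℝ → ℝ) (hf : Measurable f) (hg : Measurable g)
    (h1 : γ.map f = μ) (h2 : γ.map g = ν) (s t : ℝ) :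
    μ (Set.Iic s) - ν (Set.Iic t) ≤ γ {z | f z ≤ s ∧ t < g z} := by
  rw [← h1, ← h2, Measure.map_apply hf measurableSet_Iic, Measure.map_apply hg measurableSet_Iic]
  refine le_measure_sdiff.trans (measure_mono ?_)
  rintro z ⟨a, b⟩
  exact ⟨a, not_le.1 b⟩

theorem cost_lower {μ ν : Measure ℝ} [IsProbabilityMeasure μ] [IsProbabilityMeasure ν]
    {γ : Measure (ℝ × ℝ)} (hγ : γ ∈ Couplings μ ν) :
    ∫⁻ u, ENNReal.ofReal (|qf μ u - qf ν u| ^ (2 : ℝ)) ∂lam ≤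
      ∫⁻ z : ℝ × ℝ, ENNReal.ofReal (|z.1 - z.2| ^ (2 : ℝ)) ∂γ := by
  obtain ⟨hp, h1, h2⟩ := hγ
  have hm : AEMeasurable (fun u => (qf μ u, qf ν u)) lam :=
    (aem_of_mono (qf_mono μ)).prodMk (aem_of_mono (qf_mono ν))
  have : IsProbabilityMeasure (lam.map (fun u => (qf μ u, qf ν u))) :=
    Measure.isProbabilityMeasure_map hm
  have e : ∫⁻ u, ENNReal.ofReal (|qf μ u - qf ν u| ^ (2 : ℝ)) ∂lam =
      ∫⁻ z : ℝ × ℝ, ENNReal.ofReal (|z.1 - z.2| ^ (2 : ℝ))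
        ∂(lam.map (fun u => (qf μ u, qf ν u))) := by
    rw [lintegral_map' (by fun_prop) hm]
  rw [e, cost_eq, cost_eq]
  refine add_le_add (lintegral_mono fun p => ?_) (lintegral_mono fun p => ?_)
  · rw [Measure.map_apply_of_aemeasurable hm]
    · exact (comono_le _ _).trans
        (coupling_ge Prod.fst Prod.snd measurable_fst measurable_snd h1 h2 _ _)
    · apply meas_and <;> fun_prop
  · rw [Measure.map_apply_of_aemeasurable hm]
    · exact (comono_le _ _).trans
        (coupling_ge Prod.snd Prod.fst measurable_snd measurable_fst h2 h1 _ _)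
    · apply meas_and <;> fun_prop

theorem lint_eq {f : ℝ → ℝ} (hf : MemLp f 2 lam) :
    ∫⁻ u, ENNReal.ofReal (|f u| ^ (2 : ℝ)) ∂lam = ENNReal.ofReal (∫ u, f u ^ 2 ∂lam) := by
  rw [ofReal_integral_eq_lintegral_ofReal hf.integrable_sq (ae_of_all _ fun u => sq_nonneg _)]
  simp

theorem memLp_of {f : ℝ → ℝ} (hm : AEMeasurable f lam)
    (h : ∫⁻ u, ENNReal.ofReal (|f u| ^ (2 : ℝ)) ∂lam < ⊤) : MemLp f 2 lam := by
  rw [memLp_two_iff_integrable_sq hm.aestronglyMeasurable]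
  refine ⟨(hm.pow_const 2).aestronglyMeasurable, ?_⟩
  rw [hasFiniteIntegral_iff_ofReal (ae_of_all _ fun u => sq_nonneg _)]
  simpa using h

theorem memLp_qf {μ : Measure ℝ} (h : MemUp 2 μ) : MemLp (qf μ) 2 lam := by
  have := h.1
  have hm := aem_of_mono (qf_mono μ)
  apply memLp_of hm
  have := h.2
  rw [← map_qf μ, lintegral_map' (by fun_prop) hm] at this
  exact this

theorem memUp_map {f : ℝ → ℝ} (hf : MemLp f 2 lam) : MemUp 2 (lam.map f) := by
  refine ⟨Measure.isProbabilityMeasure_map hf.aemeasurable, ?_⟩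
  rw [lintegral_map' (by fun_prop) hf.aemeasurable, lint_eq hf]
  exact ENNReal.ofReal_lt_top

theorem coupling_map {f g : ℝ → ℝ} (hf : AEMeasurable f lam) (hg : AEMeasurable g lam) :
    lam.map (fun u => (f u, g u)) ∈ Couplings (lam.map f) (lam.map g) := by
  have hm := hf.prodMk hg
  refine ⟨Measure.isProbabilityMeasure_map hm, ?_, ?_⟩
  · rw [AEMeasurable.map_map_of_aemeasurable (by fun_prop) hm]; rfl
  · rw [AEMeasurable.map_map_of_aemeasurable (by fun_prop) hm]; rfl

theorem Wp_sq (μ ν : Measure ℝ) : Wp 2 μ ν ^ (2 : ℝ) =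
    (⨅ γ ∈ Couplings μ ν,
      ∫⁻ z : ℝ × ℝ, ENNReal.ofReal (|z.1 - z.2| ^ (2 : ℝ)) ∂γ).toReal := by
  unfold Wp
  rw [ENNReal.toReal_rpow, ← ENNReal.rpow_mul]
  norm_num

theorem inf_le {f g : ℝ → ℝ} (hf : MemLp f 2 lam) (hg : MemLp g 2 lam) :
    (⨅ γ ∈ Couplings (lam.map f) (lam.map g),
      ∫⁻ z : ℝ × ℝ, ENNReal.ofReal (|z.1 - z.2| ^ (2 : ℝ)) ∂γ) ≤
      ENNReal.ofReal (∫ u, (f u - g u) ^ 2 ∂lam) := by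
  refine (iInf₂_le _ (coupling_map hf.aemeasurable hg.aemeasurable)).trans ?_
  rw [lintegral_map' (by fun_prop) (hf.aemeasurable.prodMk hg.aemeasurable)]
  exact (lint_eq (hf.sub hg)).le

theorem Wp_le {f g : ℝ → ℝ} (hf : MemLp f 2 lam) (hg : MemLp g 2 lam) :
    Wp 2 (lam.map f) (lam.map g) ^ (2 : ℝ) ≤ ∫ u, (f u - g u) ^ 2 ∂lam := by
  rw [Wp_sq]
  exact ENNReal.toReal_le_of_le_ofReal (integral_nonneg fun u => sq_nonneg _) (inf_le hf hg)

theorem le_Wp {μ ν : Measure ℝ} (hμ : MemUp 2 μ) (hν : MemUp 2 ν) :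
    ∫ u, (qf μ u - qf ν u) ^ 2 ∂lam ≤ Wp 2 μ ν ^ (2 : ℝ) := by
  have := hμ.1
  have := hν.1
  have hf := memLp_qf hμ
  have hg := memLp_qf hν
  have h := inf_le hf hg
  rw [map_qf, map_qf] at h
  rw [Wp_sq, ← ENNReal.ofReal_le_iff_le_toReal (ne_top_of_le_ne_top ENNReal.ofReal_ne_top h)]
  refine le_iInf₂ fun γ hγ => ?_
  have := cost_lower hγ
  rwa [lint_eq (f := fun u => qf μ u - qf ν u) (hf.sub hg)] at this

theorem var_ineq {n : ℕ} (w b : Fin n → ℝ) (hs : ∑ j, w j = 1) (a : ℝ) :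
    ∑ j, w j * ((∑ k, w k * b k) - b j) ^ 2 ≤ ∑ j, w j * (a - b j) ^ 2 := by
  set m := ∑ k, w k * b k with hm
  have e : ∀ c : ℝ, ∑ j, w j * (c - b j) ^ 2 = c ^ 2 - 2 * c * m + ∑ j, w j * b j ^ 2 := by
    intro c
    have : ∀ j, w j * (c - b j) ^ 2 = w j * c ^ 2 - 2 * c * (w j * b j) + w j * b j ^ 2 := by
      intro j; ring
    simp_rw [this]
    rw [Finset.sum_add_distrib, Finset.sum_sub_distrib, ← Finset.sum_mul, ← Finset.mul_sum, hs,
      ← hm]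
    ring
  rw [e, e]
  nlinarith [sq_nonneg (a - m)]

theorem qf_map_ae {f : ℝ → ℝ} (hmono : MonotoneOn f (Set.Ioo (0 : ℝ) 1)) (hf : MemLp f 2 lam) :
    ∀ᵐ u ∂lam, qf (lam.map f) u = f u := by
  have hU := memUp_map hf
  have := hU.1
  have hq := memLp_qf hU
  have hle : ∀ᵐ u ∂lam, qf (lam.map f) u ≤ f u := by
    have : ∀ᵐ u ∂lam, u ∈ Set.Ioo (0 : ℝ) 1 := ae_restrict_mem measurableSet_Ioo
    filter_upwards [this] with u hu
    rw [qf_le_iff _ hu, Measure.map_apply_of_aemeasurable hf.aemeasurable measurableSet_Iic,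
      ← ENNReal.ofReal_le_iff_le_toReal (measure_ne_top _ _)]
    unfold lam
    rw [Measure.restrict_apply' measurableSet_Ioo]
    calc ENNReal.ofReal u = volume (Set.Ioc 0 u) := by simp
      _ ≤ volume (f ⁻¹' Set.Iic (f u) ∩ Set.Ioo 0 1) := measure_mono fun v hv =>
        ⟨hmono ⟨hv.1, hv.2.trans_lt hu.2⟩ hu hv.2, hv.1, hv.2.trans_lt hu.2⟩
  have e : ∫ u, qf (lam.map f) u ∂lam = ∫ u, f u ∂lam := by
    have h1 := integral_map (f := fun x : ℝ => x) hq.aemeasurable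
      (by fun_prop)
    have h2 := integral_map (f := fun x : ℝ => x) hf.aemeasurable
      (by fun_prop)
    rw [map_qf] at h1
    exact h1.symm.trans h2
  exact (integral_eq_iff_of_ae_le (hq.integrable (by norm_num)) (hf.integrable (by norm_num)) hle).1 e

theorem step_linear {n : ℕ} (w : Fin n → ℝ) (hw0 : ∀ j, 0 ≤ w j) (hs : ∑ j, w j = 1)
    (μs : Fin n → Measure ℝ) (hμ : ∀ j, MemUp 2 (μs j)) (η : Measure ℝ)
    (hη : ∀ χ, IsBarycenter 2 w μs χ → χ = η) :
    ∀ᵐ u ∂lam, qf η u = ∑ j, w j * qf (μs j) u := by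
  have hP : ∀ j, IsProbabilityMeasure (μs j) := fun j => (hμ j).1
  set q : ℝ → ℝ := fun u => ∑ j, w j * qf (μs j) u with hq
  have hqL : MemLp q 2 lam := memLp_finsetSum _ fun j _ => (memLp_qf (hμ j)).const_mul (w j)
  have hqm : MonotoneOn q (Set.Ioo (0 : ℝ) 1) := fun u hu v hv huv =>
    Finset.sum_le_sum fun j _ => mul_le_mul_of_nonneg_left (qf_mono (μs j) hu hv huv) (hw0 j)
  have hb : IsBarycenter 2 w μs (lam.map q) := by
    refine ⟨memUp_map hqL, fun χ hχ => ?_⟩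
    have hi : ∀ f : ℝ → ℝ, MemLp f 2 lam → ∀ j,
        Integrable (fun u => w j * (f u - qf (μs j) u) ^ 2) lam := fun f hf j =>
      ((hf.sub (memLp_qf (hμ j))).integrable_sq).const_mul (w j)
    calc ∑ j, w j * Wp 2 (lam.map q) (μs j) ^ (2 : ℝ)
        ≤ ∑ j, w j * ∫ u, (q u - qf (μs j) u) ^ 2 ∂lam := by
          refine Finset.sum_le_sum fun j _ => mul_le_mul_of_nonneg_left ?_ (hw0 j)
          have := Wp_le hqL (memLp_qf (hμ j))
          rwa [map_qf] at this
      _ = ∫ u, ∑ j, w j * (q u - qf (μs j) u) ^ 2 ∂lam := by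
          rw [integral_finsetSum _ fun j _ => hi q hqL j]
          simp_rw [integral_const_mul]
      _ ≤ ∫ u, ∑ j, w j * (qf χ u - qf (μs j) u) ^ 2 ∂lam := by
          refine integral_mono (integrable_finsetSum _ fun j _ => hi q hqL j)
            (integrable_finsetSum _ fun j _ => hi _ (memLp_qf hχ) j) fun u => ?_
          exact var_ineq w (fun j => qf (μs j) u) hs _
      _ = ∑ j, w j * ∫ u, (qf χ u - qf (μs j) u) ^ 2 ∂lam := by
          rw [integral_finsetSum _ fun j _ => hi _ (memLp_qf hχ) j]
          simp_rw [integral_const_mul]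
      _ ≤ _ := Finset.sum_le_sum fun j _ => mul_le_mul_of_nonneg_left (le_Wp hχ (hμ j)) (hw0 j)
  rw [← hη _ hb]
  exact qf_map_ae hqm hqL

/-- Along the Wasserstein consensus protocol (`p = 2`) over a
time-invariant connected undirected network, the quantile functions evolve by the linear
consensus iteration: `F_{μ_i(t+1)}⁺(u) = ∑_j w_ij F_{μ_j(t)}⁺(u)` for a.e. `u ∈ (0,1)`. -/
theorem consensus_acts_linearly_on_quantiles
    (n : ℕ) (hn : 2 ≤ n)
    (w : Fin n → Fin n → ℝ) (hw : ValidWeights w)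
    (hconn : (SimpleGraph.fromRel fun i j : Fin n => 0 < w i j).Connected)
    (μ : ℕ → Fin n → Measure ℝ)
    (h0 : ∀ i, MemUp 2 (μ 0 i))
    (hupdate : ∀ t, ConsensusStep 2 w (μ t) (μ (t + 1))) :
    ∀ (t : ℕ) (i : Fin n),
      ∀ᵐ u ∂(volume.restrict (Set.Ioo (0 : ℝ) 1)),
        qf (μ (t + 1) i) u = ∑ j, w i j * qf (μ t j) u := by
  intro t i
  have hU : ∀ j, MemUp 2 (μ t j) := by
    cases t with
    | zero => exact h0
    | succ t => exact fun j => (hupdate t j).1.1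
  exact step_linear (w i) (fun j => (hw.1 i j).1) (hw.2.2.2 i) (μ t) hU _ (hupdate t i).2

end
end

section
/- Consider n ≥ 2 agents on a time-invariant connected undirected graph 𝒢(𝒱,ℰ) with doubly stochastic weight matrix W = [w_ij], each updating its state μ_i(t) ∈ 𝒰_2(ℝ) by the Wasserstein consensus protocol with p = 2. Then for every i ∈ 𝒱, ℓ_2(μ_i(t), μ*) → 0 at an exponential rate, where μ* is the equal-weight Wasserstein barycenter of the initial measures, i.e. the minimizer over η ∈ 𝒰_2(ℝ) of (1/n) Σ_{j∈𝒱} ℓ_2(η, μ_j(0))². -/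
open MeasureTheory Filter Topology

noncomputable section

def sqSet : Set ((ℝ × ℝ) × (ℝ × ℝ)) :=
  {q | (q.1.1 ≤ q.2.1 ∧ q.1.1 ≤ q.2.2) ∧ (q.2.1 < q.1.2 ∧ q.2.2 < q.1.2)}

def sqSet' : Set ((ℝ × ℝ) × (ℝ × ℝ)) :=
  {q | (q.1.2 ≤ q.2.1 ∧ q.1.2 ≤ q.2.2) ∧ (q.2.1 < q.1.1 ∧ q.2.2 < q.1.1)}

lemma measurableSet_sqSet : MeasurableSet sqSet := by
  exact ((measurableSet_le (f := fun q : (ℝ × ℝ) × (ℝ × ℝ) => q.1.1) (g := fun q : (ℝ × ℝ) × (ℝ × ℝ) => q.2.1)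
    (by fun_prop) (by fun_prop)).inter
    (measurableSet_le (f := fun q : (ℝ × ℝ) × (ℝ × ℝ) => q.1.1) (g := fun q : (ℝ × ℝ) × (ℝ × ℝ) => q.2.2)
    (by fun_prop) (by fun_prop))).inter
    ((measurableSet_lt (f := fun q : (ℝ × ℝ) × (ℝ × ℝ) => q.2.1) (g := fun q : (ℝ × ℝ) × (ℝ × ℝ) => q.1.2)
    (by fun_prop) (by fun_prop)).inter
    (measurableSet_lt (f := fun q : (ℝ × ℝ) × (ℝ × ℝ) => q.2.2) (g := fun q : (ℝ × ℝ) × (ℝ × ℝ) => q.1.2)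
    (by fun_prop) (by fun_prop)))

lemma measurableSet_sqSet' : MeasurableSet sqSet' := by
  exact ((measurableSet_le (f := fun q : (ℝ × ℝ) × (ℝ × ℝ) => q.1.2) (g := fun q : (ℝ × ℝ) × (ℝ × ℝ) => q.2.1)
    (by fun_prop) (by fun_prop)).inter
    (measurableSet_le (f := fun q : (ℝ × ℝ) × (ℝ × ℝ) => q.1.2) (g := fun q : (ℝ × ℝ) × (ℝ × ℝ) => q.2.2)
    (by fun_prop) (by fun_prop))).inter
    ((measurableSet_lt (f := fun q : (ℝ × ℝ) × (ℝ × ℝ) => q.2.1) (g := fun q : (ℝ × ℝ) × (ℝ × ℝ) => q.1.1)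
    (by fun_prop) (by fun_prop)).inter
    (measurableSet_lt (f := fun q : (ℝ × ℝ) × (ℝ × ℝ) => q.2.2) (g := fun q : (ℝ × ℝ) × (ℝ × ℝ) => q.1.1)
    (by fun_prop) (by fun_prop)))

lemma sq_layer (x y : ℝ) : ENNReal.ofReal (|x - y| ^ (2:ℝ)) =
    (volume : Measure (ℝ × ℝ)) (Set.Ico x y ×ˢ Set.Ico x y)
      + (volume : Measure (ℝ × ℝ)) (Set.Ico y x ×ˢ Set.Ico y x) := by
  rw [Measure.volume_eq_prod, Measure.prod_prod, Measure.prod_prod, Real.volume_Ico,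
    Real.volume_Ico, Real.rpow_two, sq_abs]
  rcases le_total x y with h | h
  · rw [ENNReal.ofReal_of_nonpos (sub_nonpos.2 h), mul_zero, add_zero,
      ← ENNReal.ofReal_mul (sub_nonneg.2 h)]
    congr 1; ring
  · rw [ENNReal.ofReal_of_nonpos (sub_nonpos.2 h), mul_zero, zero_add,
      ← ENNReal.ofReal_mul (sub_nonneg.2 h)]
    congr 1; ring

lemma cost_layer (γ : Measure (ℝ × ℝ)) [SFinite γ] :
    ∫⁻ z : ℝ × ℝ, ENNReal.ofReal (|z.1 - z.2| ^ (2:ℝ)) ∂γ =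
      (∫⁻ p : ℝ × ℝ, γ {z | z.1 ≤ min p.1 p.2 ∧ max p.1 p.2 < z.2})
      + ∫⁻ p : ℝ × ℝ, γ {z | z.2 ≤ min p.1 p.2 ∧ max p.1 p.2 < z.1} := by
  have h1 := Measure.prod_apply (μ := γ) (ν := (volume : Measure (ℝ × ℝ))) measurableSet_sqSet
  have h1' := Measure.prod_apply (μ := γ) (ν := (volume : Measure (ℝ × ℝ))) measurableSet_sqSet'
  have h2 := Measure.prod_apply_symm (μ := γ) (ν := (volume : Measure (ℝ × ℝ))) measurableSet_sqSet
  have h2' := Measure.prod_apply_symm (μ := γ) (ν := (volume : Measure (ℝ × ℝ)))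
    measurableSet_sqSet'
  have e1 : ∀ p : ℝ × ℝ, ((fun z => (z, p)) ⁻¹' sqSet) =
      {z | z.1 ≤ min p.1 p.2 ∧ max p.1 p.2 < z.2} := by
    intro p; ext z; simp [sqSet]
  have e2 : ∀ p : ℝ × ℝ, ((fun z => (z, p)) ⁻¹' sqSet') =
      {z | z.2 ≤ min p.1 p.2 ∧ max p.1 p.2 < z.1} := by
    intro p; ext z; simp [sqSet']
  have e3 : ∀ z : ℝ × ℝ, (Prod.mk z ⁻¹' sqSet) = Set.Ico z.1 z.2 ×ˢ Set.Ico z.1 z.2 := by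
    intro z; ext p; simp [sqSet]; tauto
  have e4 : ∀ z : ℝ × ℝ, (Prod.mk z ⁻¹' sqSet') = Set.Ico z.2 z.1 ×ˢ Set.Ico z.2 z.1 := by
    intro z; ext p; simp [sqSet']; tauto
  simp only [e1] at h2
  simp only [e2] at h2'
  rw [← h2, ← h2', h1, h1', ← lintegral_add_left (measurable_measure_prodMk_left measurableSet_sqSet)]
  refine lintegral_congr fun z => ?_
  rw [e3, e4, sq_layer]

section mono
variable {Ω : Type*} [MeasurableSpace Ω] [LinearOrder Ω] (P : Measure Ω)
  [IsProbabilityMeasure P]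

lemma mono_compare {f g : Ω → ℝ} (hf : Monotone f) (hg : Monotone g) (hfm : Measurable f)
    (hgm : Measurable g) {γ : Measure (ℝ × ℝ)} (X Y : ℝ × ℝ → ℝ) (hX : Measurable X)
    (hY : Measurable Y)
    (h1 : γ.map X = P.map f) (h2 : γ.map Y = P.map g) (a b : ℝ) :
    P {ω | f ω ≤ a ∧ b < g ω} ≤ γ {z | X z ≤ a ∧ b < Y z} := by
  have hA : P {ω | f ω ≤ a} = γ {z | X z ≤ a} := by
    have := congrArg (fun m => m (Set.Iic a)) h1
    rw [Measure.map_apply hX measurableSet_Iic, Measure.map_apply hfm measurableSet_Iic] at this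
    exact this.symm
  have hB : P {ω | g ω ≤ b} = γ {z | Y z ≤ b} := by
    have := congrArg (fun m => m (Set.Iic b)) h2
    rw [Measure.map_apply hY measurableSet_Iic, Measure.map_apply hgm measurableSet_Iic] at this
    exact this.symm
  have eP : {ω | f ω ≤ a ∧ b < g ω} = {ω | f ω ≤ a} \ {ω | g ω ≤ b} := by
    ext ω; simp
  have eG : {z | X z ≤ a ∧ b < Y z} = {z | X z ≤ a} \ {z | Y z ≤ b} := by
    ext z; simp
  have lf : IsLowerSet {ω | f ω ≤ a} := fun x y hxy hx => (hf hxy).trans hx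
  have lg : IsLowerSet {ω | g ω ≤ b} := fun x y hxy hx => (hg hxy).trans hx
  rw [eP, eG]
  rcases lf.total lg with h | h
  · rw [Set.sdiff_eq_empty.2 h]; simp
  · rw [measure_sdiff h (measurableSet_le hgm measurable_const).nullMeasurableSet
      (measure_ne_top _ _), hA, hB]
    exact le_measure_sdiff

lemma cost_lower_s16 {f g : Ω → ℝ} (hf : Monotone f) (hg : Monotone g) (hfm : Measurable f)
    (hgm : Measurable g) {γ : Measure (ℝ × ℝ)} (hγ : γ ∈ Couplings (P.map f) (P.map g)) :
    ∫⁻ ω, ENNReal.ofReal (|f ω - g ω| ^ (2:ℝ)) ∂P ≤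
      ∫⁻ z : ℝ × ℝ, ENNReal.ofReal (|z.1 - z.2| ^ (2:ℝ)) ∂γ := by
  obtain ⟨hp, h1, h2⟩ := hγ
  have hfg : Measurable fun ω => (f ω, g ω) := hfm.prodMk hgm
  have hcost : ∫⁻ ω, ENNReal.ofReal (|f ω - g ω| ^ (2:ℝ)) ∂P =
      ∫⁻ z : ℝ × ℝ, ENNReal.ofReal (|z.1 - z.2| ^ (2:ℝ)) ∂(P.map fun ω => (f ω, g ω)) := by
    rw [lintegral_map (by fun_prop) hfg]
  have : IsProbabilityMeasure (P.map fun ω => (f ω, g ω)) :=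
    Measure.isProbabilityMeasure_map hfg.aemeasurable
  rw [hcost, cost_layer, cost_layer]
  refine add_le_add (lintegral_mono fun p => ?_) (lintegral_mono fun p => ?_)
  · have hm : MeasurableSet {z : ℝ × ℝ | z.1 ≤ min p.1 p.2 ∧ max p.1 p.2 < z.2} :=
      (measurableSet_le measurable_fst measurable_const).inter
        (measurableSet_lt measurable_const measurable_snd)
    rw [Measure.map_apply hfg hm]
    exact mono_compare P hf hg hfm hgm Prod.fst Prod.snd measurable_fst measurable_snd h1 h2 _ _
  · have hm : MeasurableSet {z : ℝ × ℝ | z.2 ≤ min p.1 p.2 ∧ max p.1 p.2 < z.1} :=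
      (measurableSet_le measurable_snd measurable_const).inter
        (measurableSet_lt measurable_const measurable_fst)
    rw [Measure.map_apply hfg hm]
    exact mono_compare P hg hf hgm hfm Prod.snd Prod.fst measurable_snd measurable_fst h2 h1 _ _

lemma Wp_map {f g : Ω → ℝ} (hf : Monotone f) (hg : Monotone g) (hfm : Measurable f)
    (hgm : Measurable g) (hf2 : MemLp f 2 P) (hg2 : MemLp g 2 P) :
    Wp 2 (P.map f) (P.map g) = Real.sqrt (∫ ω, (f ω - g ω) ^ 2 ∂P) := by
  have hfg : Measurable fun ω => (f ω, g ω) := hfm.prodMk hgm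
  have key : (⨅ γ ∈ Couplings (P.map f) (P.map g),
      ∫⁻ z : ℝ × ℝ, ENNReal.ofReal (|z.1 - z.2| ^ (2:ℝ)) ∂γ) =
      ∫⁻ ω, ENNReal.ofReal (|f ω - g ω| ^ (2:ℝ)) ∂P := by
    apply le_antisymm
    · have hmem : (P.map fun ω => (f ω, g ω)) ∈ Couplings (P.map f) (P.map g) := by
        refine ⟨?_, ?_, ?_⟩
        · exact Measure.isProbabilityMeasure_map hfg.aemeasurable
        · rw [Measure.map_map measurable_fst hfg]; rfl
        · rw [Measure.map_map measurable_snd hfg]; rfl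
      refine (iInf₂_le _ hmem).trans ?_
      · rw [lintegral_map (by fun_prop) hfg]
    · exact le_iInf₂ fun γ hγ => cost_lower_s16 P hf hg hfm hgm hγ
  have e : ∫⁻ ω, ENNReal.ofReal (|f ω - g ω| ^ (2:ℝ)) ∂P =
      ENNReal.ofReal (∫ ω, (f ω - g ω) ^ 2 ∂P) := by
    have hi : Integrable (fun ω => (f ω - g ω) ^ 2) P := (hf2.sub hg2).integrable_sq
    rw [ofReal_integral_eq_lintegral_ofReal hi
      (Eventually.of_forall fun ω => sq_nonneg _)]
    refine lintegral_congr fun ω => ?_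
    rw [Real.rpow_two, sq_abs]
  have hnn : 0 ≤ ∫ ω, (f ω - g ω) ^ 2 ∂P := integral_nonneg fun ω => sq_nonneg _
  rw [Wp, key, e, ENNReal.ofReal_rpow_of_nonneg hnn (by norm_num),
    ENNReal.toReal_ofReal (by positivity), Real.sqrt_eq_rpow]

lemma Wp_map_sq {f g : Ω → ℝ} (hf : Monotone f) (hg : Monotone g) (hfm : Measurable f)
    (hgm : Measurable g) (hf2 : MemLp f 2 P) (hg2 : MemLp g 2 P) :
    Wp 2 (P.map f) (P.map g) ^ (2:ℝ) = ∫ ω, (f ω - g ω) ^ 2 ∂P := by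
  rw [Wp_map P hf hg hfm hgm hf2 hg2, Real.rpow_two, Real.sq_sqrt]
  exact integral_nonneg fun ω => sq_nonneg _

lemma memUp_map_iff {f : Ω → ℝ} (hfm : Measurable f) : MemUp 2 (P.map f) ↔ MemLp f 2 P := by
  have e : ∫⁻ x : ℝ, ENNReal.ofReal (|x| ^ (2:ℝ)) ∂(P.map f) = ∫⁻ ω, ‖f ω‖ₑ ^ (2:ℝ) ∂P := by
    rw [lintegral_map (by fun_prop) hfm]
    refine lintegral_congr fun ω => ?_
    rw [Real.enorm_eq_ofReal_abs, ENNReal.ofReal_rpow_of_nonneg (abs_nonneg _) (by norm_num)]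
  unfold MemUp
  rw [e]
  constructor
  · rintro ⟨_, h⟩
    refine ⟨hfm.aestronglyMeasurable, ?_⟩
    rw [eLpNorm_lt_top_iff_lintegral_rpow_enorm_lt_top (by norm_num) (by norm_num)]
    simpa using h
  · intro h
    refine ⟨Measure.isProbabilityMeasure_map hfm.aemeasurable, ?_⟩
    have := h.2
    rw [eLpNorm_lt_top_iff_lintegral_rpow_enorm_lt_top (by norm_num) (by norm_num)] at this
    simpa using this

/-- monotone, measurable, square-integrable -/
def Good (f : Ω → ℝ) : Prop := Monotone f ∧ Measurable f ∧ MemLp f 2 P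

lemma Good.avg {m : ℕ} {w : Fin m → ℝ} (hw : ∀ j, 0 ≤ w j) {f : Fin m → Ω → ℝ}
    (hf : ∀ j, Good P (f j)) : Good P (fun ω => ∑ j, w j * f j ω) := by
  refine ⟨fun x y hxy => ?_, ?_, ?_⟩
  · exact Finset.sum_le_sum fun j _ => mul_le_mul_of_nonneg_left ((hf j).1 hxy) (hw j)
  · exact Finset.measurable_sum _ fun j _ => (hf j).2.1.const_mul _
  · exact memLp_finsetSum _ fun j _ => (hf j).2.2.const_mul _

lemma bary_alg {m : ℕ} {w : Fin m → ℝ} (hs : ∑ j, w j = 1) (x : Fin m → ℝ) (h : ℝ) :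
    ∑ j, w j * ((∑ k, w k * x k) - x j) ^ 2 ≤ ∑ j, w j * (h - x j) ^ 2 := by
  set a := ∑ k, w k * x k with ha
  have hx : ∀ c : ℝ, ∑ j, w j * (c - x j) ^ 2 = c ^ 2 - 2 * c * a + ∑ j, w j * x j ^ 2 := by
    intro c
    calc ∑ j, w j * (c - x j) ^ 2
        = ∑ j, (c ^ 2 * w j - 2 * c * (w j * x j) + w j * x j ^ 2) :=
          Finset.sum_congr rfl fun j _ => by ring
      _ = _ := by
          rw [Finset.sum_add_distrib, Finset.sum_sub_distrib, ← Finset.mul_sum, ← Finset.mul_sum,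
            hs, mul_one]
  rw [hx, hx]
  nlinarith [sq_nonneg (h - a)]

lemma bary_map (hq : ∀ χ, MemUp 2 χ → ∃ f : Ω → ℝ, Good P f ∧ χ = P.map f)
    {m : ℕ} {w : Fin m → ℝ} (hw : ∀ j, 0 ≤ w j) (hs : ∑ j, w j = 1) {f : Fin m → Ω → ℝ}
    (hf : ∀ j, Good P (f j)) :
    IsBarycenter 2 w (fun j => P.map (f j)) (P.map fun ω => ∑ j, w j * f j ω) := by
  have ha := Good.avg P hw hf
  refine ⟨(memUp_map_iff P ha.2.1).2 ha.2.2, fun χ hχ => ?_⟩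
  obtain ⟨h, hh, rfl⟩ := hq χ hχ
  have eq : ∀ g : Ω → ℝ, Good P g → ∑ j, w j * Wp 2 (P.map g) (P.map (f j)) ^ (2:ℝ) =
      ∫ ω, ∑ j, w j * (g ω - f j ω) ^ 2 ∂P := by
    intro g hg
    have hi : ∀ j, Integrable (fun ω => w j * (g ω - f j ω) ^ 2) P := fun j =>
      ((hg.2.2.sub (hf j).2.2).integrable_sq).const_mul _
    rw [integral_finsetSum _ fun j _ => hi j]
    refine Finset.sum_congr rfl fun j _ => ?_
    rw [Wp_map_sq P hg.1 (hf j).1 hg.2.1 (hf j).2.1 hg.2.2 (hf j).2.2, integral_const_mul]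
  have int : ∀ g : Ω → ℝ, Good P g → Integrable (fun ω => ∑ j, w j * (g ω - f j ω) ^ 2) P :=
    fun g hg => integrable_finsetSum _ fun j _ =>
      ((hg.2.2.sub (hf j).2.2).integrable_sq).const_mul _
  rw [eq _ ha, eq _ hh]
  exact integral_mono (int _ ha) (int _ hh) fun ω => bary_alg hs (fun j => f j ω) (h ω)

end mono

/-- Lebesgue measure on the open unit interval -/
def unifIoo : Measure (Set.Ioo (0:ℝ) 1) := Measure.comap Subtype.val volume

instance : IsProbabilityMeasure unifIoo := ⟨by
  rw [unifIoo, comap_subtype_coe_apply measurableSet_Ioo, Set.image_univ,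
    Subtype.range_coe, Real.volume_Ioo]
  simp⟩

lemma exists_quantile (χ : Measure ℝ) (hχ : MemUp 2 χ) :
    ∃ f : Set.Ioo (0:ℝ) 1 → ℝ, Good unifIoo f ∧ χ = Measure.map f unifIoo := by
  have := hχ.1
  let F := ProbabilityTheory.cdf χ
  have hF : ∀ x, (χ (Set.Iic x)).toReal = F x := fun x => (ProbabilityTheory.cdf_eq_real χ x).symm
  have gal : ∀ (u : Set.Ioo (0:ℝ) 1) (x : ℝ), qf χ u ≤ x ↔ (u:ℝ) ≤ F x := by
    rintro ⟨u, hu0, hu1⟩ x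
    have ne : {x : ℝ | u ≤ F x}.Nonempty := by
      have := (ProbabilityTheory.tendsto_cdf_atTop χ).eventually (eventually_ge_nhds hu1)
      exact this.exists
    have bdd : BddBelow {x : ℝ | u ≤ F x} := by
      have := (ProbabilityTheory.tendsto_cdf_atBot χ).eventually (eventually_lt_nhds hu0)
      obtain ⟨y, hy⟩ := this.exists
      refine ⟨y, fun z hz => ?_⟩
      by_contra hlt
      exact absurd ((ProbabilityTheory.monotone_cdf χ (not_le.1 hlt).le).trans_lt hy) (not_lt.2 hz)
    simp only [qf, hF]
    constructor
    · intro h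
      have : ∀ y > x, u ≤ F y := by
        intro y hy
        obtain ⟨z, hz, hzy⟩ := exists_lt_of_csInf_lt ne (h.trans_lt hy)
        exact le_trans hz (ProbabilityTheory.monotone_cdf χ hzy.le)
      have rc : Tendsto F (𝓝[>] x) (𝓝 (F x)) :=
        ((ProbabilityTheory.cdf χ).right_continuous x).mono_left
          (nhdsWithin_mono _ Set.Ioi_subset_Ici_self)
      exact ge_of_tendsto rc (eventually_mem_nhdsWithin.mono this)
    · intro h
      exact csInf_le bdd h
  have hmono : Monotone fun u : Set.Ioo (0:ℝ) 1 => qf χ u := by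
    intro u v huv
    rw [gal]
    exact le_trans huv ((gal v _).1 le_rfl)
  have hmeas : Measurable fun u : Set.Ioo (0:ℝ) 1 => qf χ u := by
    refine measurable_of_Iic fun x => ?_
    have : (fun u : Set.Ioo (0:ℝ) 1 => qf χ u) ⁻¹' Set.Iic x =
        {u : Set.Ioo (0:ℝ) 1 | (u:ℝ) ≤ F x} := by
      ext u; exact gal u x
    rw [this]
    exact measurableSet_le measurable_subtype_coe measurable_const
  have heq : χ = Measure.map (fun u : Set.Ioo (0:ℝ) 1 => qf χ u) unifIoo := by
    have := Measure.isProbabilityMeasure_map (μ := unifIoo)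
      hmeas.aemeasurable
    refine Measure.ext_of_Iic _ _ fun x => ?_
    rw [Measure.map_apply hmeas measurableSet_Iic]
    have : (fun u : Set.Ioo (0:ℝ) 1 => qf χ u) ⁻¹' Set.Iic x =
        Subtype.val ⁻¹' (Set.Iic (F x)) := by
      ext u; exact gal u x
    rw [this, unifIoo, comap_subtype_coe_apply measurableSet_Ioo, Subtype.image_preimage_coe,
      Set.inter_comm]
    have h0 : 0 ≤ F x := ProbabilityTheory.cdf_nonneg χ x
    have h1 : F x ≤ 1 := ProbabilityTheory.cdf_le_one χ x
    have hv : volume (Set.Iic (F x) ∩ Set.Ioo 0 1) = ENNReal.ofReal (F x) := by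
      apply le_antisymm
      · refine (measure_mono (t := Set.Ioc 0 (F x)) fun y hy => ⟨hy.2.1, hy.1⟩).trans ?_
        simp
      · have : Set.Ioo 0 (F x) ⊆ Set.Iic (F x) ∩ Set.Ioo 0 1 :=
          fun y hy => ⟨hy.2.le, hy.1, hy.2.trans_le h1⟩
        refine le_trans ?_ (measure_mono this)
        simp
    rw [hv, ← hF, ENNReal.ofReal_toReal (measure_ne_top _ _)]
  refine ⟨_, ⟨hmono, hmeas, ?_⟩, heq⟩
  rw [← memUp_map_iff _ hmeas, ← heq]
  exact hχ

section contraction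
variable {n : ℕ} {w : Fin n → Fin n → ℝ}

lemma var_alg {v : Fin n → ℝ} (hs : ∑ j, v j = 1) (y : Fin n → ℝ) (a : ℝ)
    (ha : a = ∑ j, v j * y j) :
    ∑ j, v j * y j ^ 2 - a ^ 2 = ∑ j, v j * (y j - a) ^ 2 := by
  calc ∑ j, v j * y j ^ 2 - a ^ 2
      = ∑ j, v j * y j ^ 2 - 2 * a * (∑ j, v j * y j) + a ^ 2 * ∑ j, v j := by
        rw [hs, ← ha]; ring
    _ = ∑ j, (v j * y j ^ 2 - 2 * a * (v j * y j) + a ^ 2 * v j) := by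
        rw [Finset.sum_add_distrib, Finset.sum_sub_distrib, ← Finset.mul_sum, ← Finset.mul_sum]
    _ = _ := Finset.sum_congr rfl fun j _ => by ring

lemma diss (hrow : ∀ i, ∑ j, w i j = 1) (hcol : ∀ j, ∑ i, w i j = 1) (y : Fin n → ℝ) :
    ∑ j, y j ^ 2 - ∑ i, (∑ j, w i j * y j) ^ 2 =
      ∑ i, ∑ j, w i j * (y j - ∑ k, w i k * y k) ^ 2 := by
  have : ∑ j, y j ^ 2 = ∑ i, ∑ j, w i j * y j ^ 2 := by
    rw [Finset.sum_comm]
    exact Finset.sum_congr rfl fun j _ => by rw [← Finset.sum_mul, hcol, one_mul]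
  rw [this, ← Finset.sum_sub_distrib]
  exact Finset.sum_congr rfl fun i _ => var_alg (hrow i) y _ rfl

lemma strict_contr (hw0 : ∀ i j, 0 ≤ w i j)
    (hwsym : ∀ i j, 0 < w i j ↔ 0 < w j i)
    (hdiag : ∀ i, 0 < w i i)
    (hrow : ∀ i, ∑ j, w i j = 1) (hcol : ∀ j, ∑ i, w i j = 1)
    (hconn : (SimpleGraph.fromRel fun i j : Fin n => 0 < w i j).Connected)
    (y : Fin n → ℝ) (hy : ∑ j, y j = 0)
    (hle : ∑ j, y j ^ 2 ≤ ∑ i, (∑ j, w i j * y j) ^ 2) : y = 0 := by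
  have hd := diss hrow hcol y
  have hnn : ∀ i j, 0 ≤ w i j * (y j - ∑ k, w i k * y k) ^ 2 :=
    fun i j => mul_nonneg (hw0 i j) (sq_nonneg _)
  have hz : ∑ i, ∑ j, w i j * (y j - ∑ k, w i k * y k) ^ 2 = 0 :=
    le_antisymm (by linarith) (Finset.sum_nonneg fun i _ => Finset.sum_nonneg fun j _ => hnn i j)
  have hz' : ∀ i j, 0 < w i j → y j = ∑ k, w i k * y k := by
    intro i j hij
    have h1 := (Finset.sum_eq_zero_iff_of_nonneg
      (fun i _ => Finset.sum_nonneg fun j _ => hnn i j)).1 hz i (Finset.mem_univ _)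
    have h2 := (Finset.sum_eq_zero_iff_of_nonneg (fun j _ => hnn i j)).1 h1 j (Finset.mem_univ _)
    rcases mul_eq_zero.1 h2 with h | h
    · exact absurd h hij.ne'
    · exact sub_eq_zero.1 (pow_eq_zero_iff (two_ne_zero)|>.1 h)
  have hadj : ∀ i j, (SimpleGraph.fromRel fun i j : Fin n => 0 < w i j).Adj i j → y i = y j := by
    intro i j h
    rw [SimpleGraph.fromRel_adj] at h
    have hij : 0 < w i j := h.2.elim id (hwsym j i).1
    rw [hz' i j hij, ← hz' i i (hdiag i)]
  have hconst : ∀ i j, y i = y j := by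
    intro i j
    obtain ⟨p⟩ := hconn.preconnected i j
    induction p with
    | nil => rfl
    | cons h _ ih => exact (hadj _ _ h).trans ih
  funext i
  have : ∑ j : Fin n, y j = n * y i := by
    rw [Finset.sum_congr rfl fun j _ => hconst j i]; simp
  rw [hy] at this
  have hn : (n:ℝ) ≠ 0 := by
    have := i.pos
    positivity
  simpa [hn] using this.symm

lemma exists_rate (hw0 : ∀ i j, 0 ≤ w i j)
    (hwsym : ∀ i j, 0 < w i j ↔ 0 < w j i)
    (hdiag : ∀ i, 0 < w i i)
    (hrow : ∀ i, ∑ j, w i j = 1) (hcol : ∀ j, ∑ i, w i j = 1)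
    (hconn : (SimpleGraph.fromRel fun i j : Fin n => 0 < w i j).Connected) :
    ∃ c : ℝ, 0 ≤ c ∧ c < 1 ∧ ∀ y : Fin n → ℝ, ∑ j, y j = 0 →
      ∑ i, (∑ j, w i j * y j) ^ 2 ≤ c * ∑ j, y j ^ 2 := by
  set K : Set (Fin n → ℝ) := {y | ∑ j, y j = 0 ∧ ∑ j, y j ^ 2 = 1} with hK
  have hKc : IsCompact K := by
    refine Metric.isCompact_of_isClosed_isBounded ?_ ?_
    · exact (isClosed_eq (by fun_prop) continuous_const).inter
        (isClosed_eq (by fun_prop) continuous_const)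
    · refine (Metric.isBounded_closedBall (x := (0 : Fin n → ℝ)) (r := 1)).subset ?_
      rintro y ⟨_, hy⟩
      rw [mem_closedBall_zero_iff, pi_norm_le_iff_of_nonneg zero_le_one]
      intro i
      rw [Real.norm_eq_abs, ← sq_le_one_iff_abs_le_one, ← hy]
      exact Finset.single_le_sum (f := fun j => y j ^ 2) (fun j _ => sq_nonneg _)
        (Finset.mem_univ i)
  have hscale : ∀ y : Fin n → ℝ, ∑ j, y j = 0 → y ≠ 0 → ∃ s : ℝ, 0 < s ∧ s ^ 2 = ∑ j, y j ^ 2 ∧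
      (fun j => s⁻¹ * y j) ∈ K := by
    intro y hy hne
    have hpos : 0 < ∑ j, y j ^ 2 := by
      obtain ⟨i, hi⟩ := Function.ne_iff.1 hne
      exact Finset.sum_pos' (fun j _ => sq_nonneg _) ⟨i, Finset.mem_univ _, by
        have : y i ≠ 0 := hi
        positivity⟩
    have hsq := Real.sq_sqrt hpos.le
    refine ⟨Real.sqrt (∑ j, y j ^ 2), Real.sqrt_pos.2 hpos, hsq, ?_, ?_⟩
    · rw [← Finset.mul_sum, hy, mul_zero]
    · simp only [mul_pow]
      rw [← Finset.mul_sum, inv_pow, hsq, inv_mul_cancel₀ hpos.ne']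
  rcases K.eq_empty_or_nonempty with hE | hne
  · refine ⟨0, le_rfl, zero_lt_one, fun y hy => ?_⟩
    by_cases h : y = 0
    · subst h; simp
    · obtain ⟨s, _, _, hs⟩ := hscale y hy h
      rw [hE] at hs
      exact hs.elim
  · obtain ⟨z, hz, hmax⟩ := hKc.exists_isMaxOn hne
      (f := fun y => ∑ i, (∑ j, w i j * y j) ^ 2) (by fun_prop)
    refine ⟨∑ i, (∑ j, w i j * z j) ^ 2, Finset.sum_nonneg fun _ _ => sq_nonneg _, ?_, ?_⟩
    · by_contra hlt
      have := strict_contr hw0 hwsym hdiag hrow hcol hconn z hz.1 (by rw [hz.2]; exact not_lt.1 hlt)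
      have h2 := hz.2
      rw [this] at h2
      simp at h2
    · intro y hy
      by_cases h : y = 0
      · subst h; simp
      · obtain ⟨s, hs0, hs, hsK⟩ := hscale y hy h
        have hm := hmax hsK
        simp only [Set.mem_ofPred_eq] at hm
        have e : ∑ i, (∑ j, w i j * (s⁻¹ * y j)) ^ 2 = (s ^ 2)⁻¹ * ∑ i, (∑ j, w i j * y j) ^ 2 := by
          rw [Finset.mul_sum]
          refine Finset.sum_congr rfl fun i _ => ?_
          rw [← inv_pow, ← mul_pow, Finset.mul_sum]
          congr 1
          exact Finset.sum_congr rfl fun j _ => by ring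
        rw [e, inv_mul_le_iff₀ (by positivity), hs] at hm
        linarith

end contraction

/-- Over a time-invariant connected undirected network with a doubly
stochastic weight matrix, the Wasserstein consensus protocol (`p = 2`) converges
exponentially fast in `ℓ_2` to the equal-weight Wasserstein barycenter of the initial
measures. -/
theorem wasserstein_average_consensus
    (n : ℕ) (hn : 2 ≤ n)
    (w : Fin n → Fin n → ℝ)
    (hw0 : ∀ i j, 0 ≤ w i j)
    (hwsym : ∀ i j, 0 < w i j ↔ 0 < w j i)
    (hdiag : ∀ i, 0 < w i i)
    (hrow : ∀ i, ∑ j, w i j = 1)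
    (hcol : ∀ j, ∑ i, w i j = 1)
    (hconn : (SimpleGraph.fromRel fun i j : Fin n => 0 < w i j).Connected)
    (μ : ℕ → Fin n → Measure ℝ)
    (h0 : ∀ i, MemUp 2 (μ 0 i))
    (hupdate : ∀ t, ConsensusStep 2 w (μ t) (μ (t + 1))) :
    ∃ μstar : Measure ℝ,
      IsBarycenter 2 (fun _ => (n : ℝ)⁻¹) (μ 0) μstar ∧
        ∃ C : ℝ, 0 ≤ C ∧ ∃ lam : ℝ, 0 ≤ lam ∧ lam < 1 ∧
          ∀ t i, Wp 2 (μ t i) μstar ≤ C * lam ^ t := by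
  let P := unifIoo
  have hq : ∀ χ, MemUp 2 χ → ∃ f : Set.Ioo (0:ℝ) 1 → ℝ, Good P f ∧ χ = P.map f := exists_quantile
  choose f0 hf0 hμ0 using fun i => hq _ (h0 i)
  let F : ℕ → Fin n → Set.Ioo (0:ℝ) 1 → ℝ := fun t =>
    Nat.rec f0 (fun _ G i ω => ∑ j, w i j * G j ω) t
  have hFs : ∀ t i ω, F (t + 1) i ω = ∑ j, w i j * F t j ω := fun _ _ _ => rfl
  have hFg : ∀ t i, Good P (F t i) := by
    intro t
    induction t with
    | zero => exact hf0
    | succ t ih => exact fun i => Good.avg P (hw0 i) ih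
  have hμ : ∀ t i, μ t i = P.map (F t i) := by
    intro t
    induction t with
    | zero => exact hμ0
    | succ t ih =>
      intro i
      have hb := bary_map P hq (hw0 i) (hrow i) (hFg t)
      have e : (fun j => P.map (F t j)) = μ t := funext fun j => (ih j).symm
      rw [e] at hb
      exact ((hupdate t i).2 _ hb).symm
  have hnpos : (0:ℝ) < n := by positivity
  have hninv : ∀ _ : Fin n, (0:ℝ) ≤ (n:ℝ)⁻¹ := fun _ => by positivity
  have hnsum : ∑ _ : Fin n, (n:ℝ)⁻¹ = 1 := by simp [hnpos.ne']
  let A : Set.Ioo (0:ℝ) 1 → ℝ := fun ω => ∑ j, (n:ℝ)⁻¹ * f0 j ω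
  have hA : Good P A := Good.avg P hninv hf0
  obtain ⟨c, hc0, hc1, hc⟩ := exists_rate hw0 hwsym hdiag hrow hcol hconn
  have hsum : ∀ t ω, ∑ i, (F t i ω - A ω) = 0 := by
    intro t ω
    induction t with
    | zero =>
      have : ∑ i, F 0 i ω = n * A ω := by
        change ∑ i, f0 i ω = n * ∑ j, (n:ℝ)⁻¹ * f0 j ω
        rw [← Finset.mul_sum, mul_inv_cancel_left₀ hnpos.ne']
      rw [Finset.sum_sub_distrib, this]; simp
    | succ t ih =>
      rw [Finset.sum_sub_distrib] at ih ⊢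
      rw [← ih]
      congr 1
      simp only [hFs]
      rw [Finset.sum_comm]
      exact Finset.sum_congr rfl fun j _ => by rw [← Finset.sum_mul, hcol, one_mul]
  have hstep : ∀ t i ω, F (t + 1) i ω - A ω = ∑ j, w i j * (F t j ω - A ω) := by
    intro t i ω
    simp only [mul_sub]
    rw [Finset.sum_sub_distrib, ← Finset.sum_mul, hrow, one_mul, hFs]
  have hbound : ∀ t ω, ∑ i, (F t i ω - A ω) ^ 2 ≤ c ^ t * ∑ i, (F 0 i ω - A ω) ^ 2 := by
    intro t ω
    induction t with
    | zero => simp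
    | succ t ih =>
      simp only [hstep]
      calc _ ≤ c * ∑ i, (F t i ω - A ω) ^ 2 := hc _ (hsum t ω)
        _ ≤ c * (c ^ t * ∑ i, (F 0 i ω - A ω) ^ 2) := mul_le_mul_of_nonneg_left ih hc0
        _ = _ := by ring
  refine ⟨P.map A, ?_, Real.sqrt (∫ ω, ∑ i, (F 0 i ω - A ω) ^ 2 ∂P), Real.sqrt_nonneg _,
    Real.sqrt c, Real.sqrt_nonneg _, ?_, ?_⟩
  · have hb := bary_map P hq hninv hnsum hf0
    have e : (fun j => P.map (f0 j)) = μ 0 := funext fun j => (hμ0 j).symm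
    rw [e] at hb
    exact hb
  · rw [Real.sqrt_lt' one_pos]; simpa using hc1
  · intro t i
    have hG := hFg t i
    have int0 : ∀ t i, Integrable (fun ω => (F t i ω - A ω) ^ 2) P := fun t i =>
      ((hFg t i).2.2.sub hA.2.2).integrable_sq
    rw [hμ, Wp_map P hG.1 hA.1 hG.2.1 hA.2.1 hG.2.2 hA.2.2]
    have hI : ∫ ω, (F t i ω - A ω) ^ 2 ∂P ≤ c ^ t * ∫ ω, ∑ i, (F 0 i ω - A ω) ^ 2 ∂P := by
      rw [← integral_const_mul]
      refine integral_mono (int0 t i)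
        ((integrable_finsetSum _ fun j _ => int0 0 j).const_mul _) fun ω => ?_
      exact (Finset.single_le_sum (f := fun j => (F t j ω - A ω) ^ 2) (fun j _ => sq_nonneg _)
        (Finset.mem_univ i)).trans (hbound t ω)
    refine (Real.sqrt_le_sqrt hI).trans (le_of_eq ?_)
    rw [Real.sqrt_mul (pow_nonneg hc0 t), mul_comm]
    congr 1
    rw [Real.sqrt_eq_iff_mul_self_eq (pow_nonneg hc0 t) (by positivity), ← mul_pow,
      Real.mul_self_sqrt hc0]

end
end
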